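/- arXiv:2603.13828 — 6 statements merged into one kernel-verified Lean document; each statement's English description precedes it below -/
import Mathlib

section
/- Under the stated setup, suppose {1,…,N} is partitioned into two disjoint sets V₁ and V₂ such that: (i) for every j ∈ V₂ there exist i ∈ V₁ and a positive–negative path from i to j; (ii) every j ∈ V₂ is in-degree-dominated; and (iii) for every i ∈ V₁ the matrix B_i = Σ_{j∈Ω_i}|A_{ij}| is positive definite and the matrix 2δ·B_i − (Σ_{j∈N'_i}|A_{ji}| − Σ_{j∈N_i}|A_{ij}|) is positive definite (the latter being equivalent to δ > C_i = ½·λ_max(B_i^{-1}(Σ_{j∈N'_i}|A_{ji}| − Σ_{j∈N_i}|A_{ij}|))). Then every eigenvalue μ of the grounded Laplacian L_B, regarded as a complex Nd×Nd matrix, satisfies Re(μ) > 0; equivalently, −L_B is a Hurwitz matrix. -/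
open scoped Classical

noncomputable section

/-- The matrix-valued sign of a symmetric matrix that is positive or negative semidefinite:
`1` if it is positive semidefinite and nonzero, `-1` if negative semidefinite and nonzero,
`0` if it is the zero matrix. -/
def mwSgn {d : ℕ} (M : Matrix (Fin d) (Fin d) ℝ) : ℝ :=
  if M = 0 then 0 else if M.PosSemidef then 1 else -1

/-- `|M| = sgn(M) • M`. -/
def mwAbs {d : ℕ} (M : Matrix (Fin d) (Fin d) ℝ) : Matrix (Fin d) (Fin d) ℝ :=
  mwSgn M • M

/-- `B_i = Σ_{j ∈ Ω_i} |A_{ij}|`, the sum of `|A_{ij}|` over the incoming negative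
(semi-)definite edges of vertex `i`. -/
def omegaSum {N d : ℕ} (A : Fin N → Fin N → Matrix (Fin d) (Fin d) ℝ) (i : Fin N) :
    Matrix (Fin d) (Fin d) ℝ :=
  ∑ j, if mwSgn (A i j) = -1 then mwAbs (A i j) else 0

/-- The `(i,j)` block of the signed matrix-weighted Laplacian:
`L_{ii} = Σ_{k ≠ i} |A_{ik}|` and `L_{ij} = -A_{ij}` for `j ≠ i`. -/
def lapBlock {N d : ℕ} (A : Fin N → Fin N → Matrix (Fin d) (Fin d) ℝ) (i j : Fin N) :
    Matrix (Fin d) (Fin d) ℝ :=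
  if i = j then ∑ k ∈ Finset.univ.erase i, mwAbs (A i k) else -(A i j)

/-- The signed matrix-weighted Laplacian `L ∈ ℝ^{Nd × Nd}`, as a matrix indexed by
`Fin N × Fin d`. -/
def signedLaplacian {N d : ℕ} (A : Fin N → Fin N → Matrix (Fin d) (Fin d) ℝ) :
    Matrix (Fin N × Fin d) (Fin N × Fin d) ℝ :=
  Matrix.of fun p q => lapBlock A p.1 q.1 p.2 q.2

/-- `δ_i = δ` if `i ∈ 𝒰` (vertex `i` has an incoming negative edge) and `δ_i = 0` otherwise. -/
def deltaCoef {N d : ℕ} (A : Fin N → Fin N → Matrix (Fin d) (Fin d) ℝ) (δ : ℝ) (i : Fin N) :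
    ℝ :=
  if ∃ j, mwSgn (A i j) = -1 then δ else 0

/-- The grounded Laplacian `L_B`: `L` with the `i`-th diagonal block replaced by
`L_{ii} + δ_i • B_i`. -/
def groundedLaplacian {N d : ℕ} (A : Fin N → Fin N → Matrix (Fin d) (Fin d) ℝ) (δ : ℝ) :
    Matrix (Fin N × Fin d) (Fin N × Fin d) ℝ :=
  Matrix.of fun p q =>
    (if p.1 = q.1 then lapBlock A p.1 p.1 + deltaCoef A δ p.1 • omegaSum A p.1
     else lapBlock A p.1 q.1) p.2 q.2

end

open Matrix Finset

theorem mwAbs_of_posSemidef {d : ℕ} {M : Matrix (Fin d) (Fin d) ℝ} (h : M.PosSemidef) :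
    mwAbs M = M := by
  by_cases h0 : M = 0
  · simp [mwAbs, h0]
  · simp [mwAbs, mwSgn, h0, h]

theorem mwAbs_of_not_posSemidef {d : ℕ} {M : Matrix (Fin d) (Fin d) ℝ} (h : ¬ M.PosSemidef) :
    mwAbs M = -M := by
  have h0 : M ≠ 0 := by
    rintro rfl
    exact h Matrix.PosSemidef.zero
  simp [mwAbs, mwSgn, h0, h]

theorem mwAbs_zero {d : ℕ} : mwAbs (0 : Matrix (Fin d) (Fin d) ℝ) = 0 := by
  simp [mwAbs]

theorem mwAbs_posSemidef {d : ℕ} {M : Matrix (Fin d) (Fin d) ℝ}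
    (h : M.PosSemidef ∨ (-M).PosSemidef) : (mwAbs M).PosSemidef := by
  by_cases hM : M.PosSemidef
  · rwa [mwAbs_of_posSemidef hM]
  · rw [mwAbs_of_not_posSemidef hM]
    exact h.resolve_left hM

theorem mwAbs_posDef {d : ℕ} {M : Matrix (Fin d) (Fin d) ℝ}
    (h : M.PosDef ∨ (-M).PosDef) : (mwAbs M).PosDef := by
  by_cases hM : M.PosSemidef
  · rw [mwAbs_of_posSemidef hM]
    refine h.elim id fun hneg => ?_
    have key : ∀ x : Fin d → ℝ, x = 0 := fun x => by
      by_contra hx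
      have h1 := hneg.dotProduct_mulVec_pos hx
      have h2 := hM.dotProduct_mulVec_nonneg x
      simp only [neg_mulVec, dotProduct_neg] at h1
      linarith
    exact .of_dotProduct_mulVec_pos hM.isHermitian fun x hx => (hx (key x)).elim
  · rw [mwAbs_of_not_posSemidef hM]
    exact h.resolve_left fun h' => hM h'.posSemidef

/-- Completing the square along one signed edge. -/
theorem dotProduct_mwAbs_sub_smul {d : ℕ} {M : Matrix (Fin d) (Fin d) ℝ} (hM : M.IsSymm)
    (x y : Fin d → ℝ) :
    (x - mwSgn M • y) ⬝ᵥ mwAbs M *ᵥ (x - mwSgn M • y) =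
      x ⬝ᵥ mwAbs M *ᵥ x + y ⬝ᵥ mwAbs M *ᵥ y - 2 * (x ⬝ᵥ M *ᵥ y) := by
  have hc : y ⬝ᵥ M *ᵥ x = x ⬝ᵥ M *ᵥ y := by
    rw [dotProduct_mulVec, ← mulVec_transpose, hM.eq, dotProduct_comm]
  by_cases h0 : M = 0
  · subst h0
    simp [mwAbs_zero]
  by_cases h : M.PosSemidef
  · have hs : mwSgn M = 1 := by simp [mwSgn, h0, h]
    rw [hs, mwAbs_of_posSemidef h]
    simp only [one_smul, mulVec_sub, dotProduct_sub, sub_dotProduct, hc]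
    ring
  · have hs : mwSgn M = -1 := by simp [mwSgn, h0, h]
    rw [hs, mwAbs_of_not_posSemidef h]
    simp only [neg_smul, one_smul, sub_neg_eq_add, mulVec_add, dotProduct_add, add_dotProduct,
      neg_mulVec, dotProduct_neg, hc]
    ring

theorem omegaSum_posSemidef {N d : ℕ} {A : Fin N → Fin N → Matrix (Fin d) (Fin d) ℝ}
    (hsign : ∀ i j, (A i j).PosSemidef ∨ (-(A i j)).PosSemidef) (i : Fin N) :
    (omegaSum A i).PosSemidef := by
  refine posSemidef_sum _ fun j _ => ?_
  split_ifs
  · exact mwAbs_posSemidef (hsign i j)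
  · exact .zero

theorem dotProduct_groundedLaplacian_mulVec {N d : ℕ}
    {A : Fin N → Fin N → Matrix (Fin d) (Fin d) ℝ} (hdiag : ∀ i, A i i = 0) (δ : ℝ)
    (z : Fin N × Fin d → ℝ) :
    z ⬝ᵥ groundedLaplacian A δ *ᵥ z =
      ∑ i, ((fun a => z (i, a)) ⬝ᵥ (∑ k ∈ univ.erase i, mwAbs (A i k)
          + deltaCoef A δ i • omegaSum A i) *ᵥ (fun a => z (i, a))
        - ∑ j, (fun a => z (i, a)) ⬝ᵥ A i j *ᵥ (fun a => z (j, a))) := by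
  have hblock : ∀ (i j : Fin N) (a b : Fin d), groundedLaplacian A δ (i, a) (j, b) =
      (if j = i then (∑ k ∈ univ.erase i, mwAbs (A i k) + deltaCoef A δ i • omegaSum A i) a b
        else 0) - A i j a b := by
    intro i j a b
    by_cases h : i = j
    · subst h
      simp [groundedLaplacian, lapBlock, hdiag]
    · simp [groundedLaplacian, lapBlock, h, Ne.symm h]
  simp only [dotProduct, mulVec, Fintype.sum_prod_type, hblock]
  refine sum_congr rfl fun i _ => ?_
  rw [sum_comm (s := univ) (t := univ) (f := fun j a => z (i, a) * ∑ b, A i j a b * z (j, b)),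
    ← sum_sub_distrib]
  refine sum_congr rfl fun a _ => ?_
  rw [← mul_sum, ← mul_sub]
  congr 1
  simp only [sub_mul, sum_sub_distrib]
  congr 1
  rw [sum_comm]
  simp [ite_mul]

/-- Twice the quadratic form of the grounded Laplacian as a sum of edge squares and
in/out-degree imbalances. -/
theorem two_mul_dotProduct_groundedLaplacian_mulVec {N d : ℕ}
    {A : Fin N → Fin N → Matrix (Fin d) (Fin d) ℝ} (hsymm : ∀ i j, (A i j).IsSymm)
    (hdiag : ∀ i, A i i = 0) (δ : ℝ) (z : Fin N × Fin d → ℝ) :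
    2 * (z ⬝ᵥ groundedLaplacian A δ *ᵥ z) =
      ∑ i, ∑ j, ((fun a => z (i, a)) - mwSgn (A i j) • (fun a => z (j, a))) ⬝ᵥ
          mwAbs (A i j) *ᵥ ((fun a => z (i, a)) - mwSgn (A i j) • (fun a => z (j, a)))
        + ∑ i, (fun a => z (i, a)) ⬝ᵥ ((2 * deltaCoef A δ i) • omegaSum A i
          - (∑ j ∈ univ.erase i, mwAbs (A j i) - ∑ j ∈ univ.erase i, mwAbs (A i j))) *ᵥ
            (fun a => z (i, a)) := by
  have h1 : ∀ i, ∑ j ∈ univ.erase i, mwAbs (A j i) = ∑ j, mwAbs (A j i) := fun i =>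
    sum_erase _ (by rw [hdiag, mwAbs_zero])
  have h2 : ∀ i, ∑ j ∈ univ.erase i, mwAbs (A i j) = ∑ j, mwAbs (A i j) := fun i =>
    sum_erase _ (by rw [hdiag, mwAbs_zero])
  rw [dotProduct_groundedLaplacian_mulVec hdiag]
  simp only [dotProduct_mwAbs_sub_smul (hsymm _ _), h1, h2, sub_mulVec, add_mulVec, smul_mulVec,
    sum_mulVec, dotProduct_sub, dotProduct_add, dotProduct_smul, dotProduct_sum,
    sum_add_distrib, sum_sub_distrib, smul_eq_mul, mul_assoc, ← mul_sum]
  rw [sum_comm (f := fun i j => (fun a => z (j, a)) ⬝ᵥ mwAbs (A i j) *ᵥ (fun a => z (j, a)))]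
  ring

/-- A real matrix whose quadratic form is positive off zero has its complex spectrum in the open
right half-plane. -/
theorem re_pos_of_mem_spectrum_map_ofReal {n : Type*} [Fintype n] [DecidableEq n]
    {M : Matrix n n ℝ} (hM : ∀ x : n → ℝ, x ≠ 0 → 0 < x ⬝ᵥ M *ᵥ x)
    {μ : ℂ} (hμ : μ ∈ spectrum ℂ (M.map Complex.ofReal)) : 0 < μ.re := by
  rw [← Matrix.spectrum_toLin', ← Module.End.hasEigenvalue_iff_mem_spectrum] at hμ
  obtain ⟨v, hv⟩ := hμ.exists_hasEigenvector
  have hv1 : M.map Complex.ofReal *ᵥ v = μ • v := by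
    simpa using hv.apply_eq_smul
  have hre : M *ᵥ (fun p => (v p).re) =
      μ.re • (fun p => (v p).re) - μ.im • (fun p => (v p).im) := by
    ext p
    simpa [mulVec, dotProduct] using congrArg Complex.re (congrFun hv1 p)
  have him : M *ᵥ (fun p => (v p).im) =
      μ.re • (fun p => (v p).im) + μ.im • (fun p => (v p).re) := by
    ext p
    simpa [mulVec, dotProduct] using congrArg Complex.im (congrFun hv1 p)
  set a : n → ℝ := fun p => (v p).re
  set b : n → ℝ := fun p => (v p).im
  have hnonneg : ∀ x : n → ℝ, 0 ≤ x ⬝ᵥ M *ᵥ x := fun x => by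
    by_cases hx : x = 0
    · simp [hx]
    · exact (hM x hx).le
  have hpos : 0 < a ⬝ᵥ M *ᵥ a + b ⬝ᵥ M *ᵥ b := by
    by_cases ha : a = 0
    · have hb : b ≠ 0 := fun hb => hv.2 <| funext fun p =>
        Complex.ext (congrFun ha p) (congrFun hb p)
      exact add_pos_of_nonneg_of_pos (hnonneg a) (hM b hb)
    · exact add_pos_of_pos_of_nonneg (hM a ha) (hnonneg b)
  have heq : a ⬝ᵥ M *ᵥ a + b ⬝ᵥ M *ᵥ b = μ.re * (a ⬝ᵥ a + b ⬝ᵥ b) := by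
    rw [hre, him]
    simp only [dotProduct_sub, dotProduct_add, dotProduct_smul, smul_eq_mul,
      dotProduct_comm b a]
    ring
  rw [heq] at hpos
  refine pos_of_mul_pos_left hpos (add_nonneg ?_ ?_) <;>
  exact sum_nonneg fun p _ => mul_self_nonneg _

/-- **Lemma 1 / grounded Laplacian spectrum (Statement 0).**
Under the partition condition (positive–negative paths from `V₁` into `V₂`,
in-degree domination on `V₂`), with `B_i = Σ_{j∈Ω_i}|A_{ij}|` positive definite and
`2δ B_i - (Σ_{j∈N'_i}|A_{ji}| - Σ_{j∈N_i}|A_{ij}|)` positive definite for each `i ∈ V₁`,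
every eigenvalue of the grounded Laplacian `L_B` over `ℂ` has strictly positive real part;
equivalently, `-L_B` is Hurwitz. -/
theorem grounded_laplacian_positive_spectrum (N d : ℕ) (hN : 1 ≤ N) (hd : 1 ≤ d)
    (A : Fin N → Fin N → Matrix (Fin d) (Fin d) ℝ)
    (hsymm : ∀ i j, (A i j).IsSymm)
    (hdiag : ∀ i, A i i = 0)
    (hsign : ∀ i j, (A i j).PosSemidef ∨ (-(A i j)).PosSemidef)
    (δ : ℝ) (hδ : 0 < δ)
    (V₁ V₂ : Finset (Fin N))
    (hunion : V₁ ∪ V₂ = Finset.univ) (hdisj : Disjoint V₁ V₂)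
    (hpath : ∀ j ∈ V₂, ∃ i ∈ V₁, ∃ k : ℕ, ∃ u : Fin (k + 1) → Fin N,
      u 0 = i ∧ u (Fin.last k) = j ∧
      ∀ m : Fin k,
        (A (u m.succ) (u m.castSucc)).PosDef ∨ (-(A (u m.succ) (u m.castSucc))).PosDef)
    (hindeg : ∀ j ∈ V₂,
      (∑ k ∈ Finset.univ.erase j, mwAbs (A j k)
        - ∑ k ∈ Finset.univ.erase j, mwAbs (A k j)).PosSemidef)
    (hBpd : ∀ i ∈ V₁, (omegaSum A i).PosDef)
    (hδC : ∀ i ∈ V₁,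
      ((2 * δ) • omegaSum A i
        - (∑ j ∈ Finset.univ.erase i, mwAbs (A j i)
            - ∑ j ∈ Finset.univ.erase i, mwAbs (A i j))).PosDef) :
    ∀ μ ∈ spectrum ℂ ((groundedLaplacian A δ).map Complex.ofReal), 0 < μ.re := by
  have hδV₁ : ∀ i ∈ V₁, deltaCoef A δ i = δ := by
    intro i hi
    refine if_pos ?_
    by_contra! hno
    have h0 : omegaSum A i = 0 := sum_eq_zero fun j _ => if_neg (hno j)
    have hx : (fun _ => 1 : Fin d → ℝ) ≠ 0 := fun h => one_ne_zero (congrFun h ⟨0, hd⟩)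
    have := (hBpd i hi).dotProduct_mulVec_pos hx
    simp [h0] at this
  have hδnonneg : ∀ i, 0 ≤ deltaCoef A δ i := by
    intro i
    unfold deltaCoef
    split_ifs
    exacts [hδ.le, le_rfl]
  have hmem : ∀ i, i ∈ V₁ ∨ i ∈ V₂ := fun i => by
    rw [← mem_union, hunion]
    exact mem_univ i
  refine fun μ hμ => re_pos_of_mem_spectrum_map_ofReal (fun z hz => ?_) hμ
  have hkey := two_mul_dotProduct_groundedLaplacian_mulVec hsymm hdiag δ z
  set x : Fin N → Fin d → ℝ := fun i a => z (i, a)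
  have hedge : ∀ i j, 0 ≤ (x i - mwSgn (A i j) • x j) ⬝ᵥ
      mwAbs (A i j) *ᵥ (x i - mwSgn (A i j) • x j) := fun i j =>
    (mwAbs_posSemidef (hsign i j)).dotProduct_mulVec_nonneg _
  have himb : ∀ i, ((2 * deltaCoef A δ i) • omegaSum A i
      - (∑ j ∈ univ.erase i, mwAbs (A j i) - ∑ j ∈ univ.erase i, mwAbs (A i j))).PosSemidef := by
    intro i
    rcases hmem i with hi | hi
    · rw [hδV₁ i hi]
      exact (hδC i hi).posSemidef
    · rw [sub_eq_add_neg, neg_sub]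
      exact ((omegaSum_posSemidef hsign i).smul
        (mul_nonneg zero_le_two (hδnonneg i))).add (hindeg i hi)
  have hnode : ∀ i, 0 ≤ x i ⬝ᵥ ((2 * deltaCoef A δ i) • omegaSum A i
      - (∑ j ∈ univ.erase i, mwAbs (A j i) - ∑ j ∈ univ.erase i, mwAbs (A i j))) *ᵥ x i :=
    fun i => (himb i).dotProduct_mulVec_nonneg _
  have hrow : ∀ i, 0 ≤ ∑ j, (x i - mwSgn (A i j) • x j) ⬝ᵥ
      mwAbs (A i j) *ᵥ (x i - mwSgn (A i j) • x j) := fun i => sum_nonneg fun j _ => hedge i j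
  by_contra! hle
  have hedges := sum_nonneg fun i (_ : i ∈ univ) => hrow i
  have hnodes := sum_nonneg fun i (_ : i ∈ univ) => hnode i
  have hedge0 : ∀ i j, (x i - mwSgn (A i j) • x j) ⬝ᵥ
      mwAbs (A i j) *ᵥ (x i - mwSgn (A i j) • x j) = 0 := fun i j =>
    (sum_eq_zero_iff_of_nonneg fun j _ => hedge i j).1
      ((sum_eq_zero_iff_of_nonneg fun i _ => hrow i).1 (by linarith) i (mem_univ i)) j (mem_univ j)
  have hnode0 := (sum_eq_zero_iff_of_nonneg fun i (_ : i ∈ univ) => hnode i).1 (by linarith)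
  have hV₁ : ∀ i ∈ V₁, x i = 0 := by
    intro i hi
    by_contra hx
    have h1 := hnode0 i (mem_univ i)
    rw [hδV₁ i hi] at h1
    exact ((hδC i hi).dotProduct_mulVec_pos hx).ne' h1
  have hstep : ∀ i j, (A j i).PosDef ∨ (-(A j i)).PosDef → x i = 0 → x j = 0 := by
    intro i j hA hi
    by_contra hx
    have h1 := hedge0 j i
    rw [hi, smul_zero, sub_zero] at h1
    exact ((mwAbs_posDef hA).dotProduct_mulVec_pos hx).ne' h1
  have hall : ∀ j, x j = 0 := by
    intro j
    rcases hmem j with hj | hj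
    · exact hV₁ j hj
    · obtain ⟨i, hi, k, u, hu0, hul, hu⟩ := hpath j hj
      rw [← hul]
      exact Fin.induction (motive := fun m => x (u m) = 0) (by rw [hu0]; exact hV₁ i hi)
        (fun m hm => hstep _ _ (hu m) hm) (Fin.last k)
  exact hz (funext fun p => congrFun (hall p.1) p.2)
end

section
/- Let A be a real n×n matrix all of whose eigenvalues, regarded over the complex numbers, have strictly negative real part. Then there exists a symmetric positive definite matrix P ∈ ℝ^{n×n} such that Aᵀ·P + P·A = −I_n. -/
open Filter Topology in
/-- In a complex Banach algebra, the powers of an element of spectral radius less than one are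
norm-summable. -/
theorem summable_norm_pow_of_spectralRadius_lt_one {B : Type*} [NormedRing B]
    [NormedAlgebra ℂ B] [CompleteSpace B] {a : B} (ha : spectralRadius ℂ a < 1) :
    Summable fun k : ℕ => ‖a ^ k‖ := by
  obtain ⟨r, har, hr⟩ := ENNReal.lt_iff_exists_nnreal_btwn.mp ha
  have hr1 : r < 1 := by exact_mod_cast hr
  refine summable_of_isBigO_nat (g := fun k => (r : ℝ) ^ k)
    (summable_geometric_of_lt_one r.2 (by exact_mod_cast hr1)) ?_
  refine Asymptotics.IsBigO.of_bound 1 ?_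
  filter_upwards [(spectrum.pow_nnnorm_pow_one_div_tendsto_nhds_spectralRadius a).eventually_lt_const
    har, eventually_gt_atTop 0] with k hk hk0
  have hk' : (‖a ^ k‖₊ : ENNReal) ≤ (r : ENNReal) ^ k := by
    have h := ENNReal.rpow_le_rpow hk.le (Nat.cast_nonneg (α := ℝ) k)
    rwa [← ENNReal.rpow_mul, one_div_mul_cancel (by exact_mod_cast hk0.ne'), ENNReal.rpow_one,
      ENNReal.rpow_natCast] at h
  have : ‖a ^ k‖₊ ≤ r ^ k := by exact_mod_cast hk'
  have : ‖a ^ k‖ ≤ (r : ℝ) ^ k := by exact_mod_cast this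
  simpa using this

/-- If the spectrum of `b` lies in the open left half-plane, then the spectrum of its Cayley
transform `c = (1 + b) (1 - b)⁻¹` lies in the open unit disk. -/
theorem norm_lt_one_of_mem_spectrum_cayley {B : Type*} [Ring B] [Algebra ℂ B] {b c : B}
    (hb : ∀ μ ∈ spectrum ℂ b, μ.re < 0) (hc : c * (1 - b) = 1 + b) {μ : ℂ}
    (hμ : μ ∈ spectrum ℂ c) : ‖μ‖ < 1 := by
  by_contra! h
  have key (z : ℂ) (hz : 0 ≤ z.re) : IsUnit (algebraMap ℂ B z - b) := by
    by_contra hn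
    exact (hb z hn).not_ge hz
  have hu : IsUnit (1 - b) := by simpa using key 1 (by simp)
  refine hμ ((hu.mul_right_iff).mp ?_)
  have hfac : (algebraMap ℂ B μ - c) * (1 - b) =
      algebraMap ℂ B (μ - 1) - algebraMap ℂ B (μ + 1) * b := by
    rw [sub_mul, hc, map_sub, map_add, map_one]
    noncomm_ring
  rw [hfac]
  by_cases h1 : μ + 1 = 0
  · have : μ - 1 ≠ 0 := fun h2 => by
      have : (2 : ℂ) = 0 := by linear_combination h1 - h2
      norm_num at this
    simpa [h1] using (IsUnit.mk0 _ this).map (algebraMap ℂ B)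
  · have hre : 0 ≤ ((μ - 1) / (μ + 1)).re := by
      have h2 : 1 ≤ μ.re * μ.re + μ.im * μ.im := by
        rw [← Complex.normSq_apply, Complex.normSq_eq_norm_sq]
        nlinarith
      rw [Complex.div_re, ← add_div]
      refine div_nonneg ?_ (Complex.normSq_nonneg _)
      simp
      nlinarith
    have := ((IsUnit.mk0 _ h1).map (algebraMap ℂ B)).mul (key _ hre)
    rwa [mul_sub, ← map_mul, mul_div_cancel₀ _ h1] at this

section
open Matrix
attribute [local instance] Matrix.frobeniusNormedRing Matrix.frobeniusNormedAlgebra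

/-- Solution of the discrete Lyapunov (Stein) equation. -/
theorem exists_posDef_stein {n : Type*} [Fintype n] [DecidableEq n] {C Q : Matrix n n ℝ}
    (hC : Summable fun k : ℕ => ‖C ^ k‖) (hQ : Q.PosDef) :
    ∃ P : Matrix n n ℝ, P.PosDef ∧ P - Cᵀ * P * C = Q := by
  let f : ℕ → Matrix n n ℝ := fun k => (C ^ k)ᵀ * Q * C ^ k
  have hf : Summable f := by
    refine Summable.of_norm_bounded_eventually_nat (hC.mul_left ‖Q‖) ?_
    filter_upwards [hC.tendsto_atTop_zero.eventually_le_const one_pos] with k hk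
    calc ‖f k‖ ≤ ‖(C ^ k)ᵀ‖ * ‖Q‖ * ‖C ^ k‖ :=
          (norm_mul_le _ _).trans (by gcongr; exact norm_mul_le _ _)
      _ ≤ 1 * ‖Q‖ * ‖C ^ k‖ := by
          gcongr
          rwa [frobenius_norm_transpose]
      _ = ‖Q‖ * ‖C ^ k‖ := by rw [one_mul]
  have hfpos (k : ℕ) : (f k).PosSemidef := by
    simpa [f, conjTranspose_eq_transpose_of_trivial] using
      hQ.posSemidef.conjTranspose_mul_mul_same (C ^ k)
  have heq : ∑' k, f k = Q + Cᵀ * (∑' k, f k) * C := by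
    rw [← hf.tsum_mul_left, ← (hf.mul_left _).tsum_mul_right]
    conv_lhs => rw [hf.tsum_eq_zero_add]
    congr 1
    · simp [f]
    · exact tsum_congr fun k => by simp only [f, pow_succ, transpose_mul, Matrix.mul_assoc]
  have hpsd : (∑' k, f k).PosSemidef := by
    refine .of_dotProduct_mulVec_nonneg ?_ fun x => ?_
    · rw [IsHermitian, conjTranspose_tsum]
      exact tsum_congr fun k => (hfpos k).isHermitian
    · have hcont : Continuous fun M : Matrix n n ℝ => star x ⬝ᵥ (M *ᵥ x) := by fun_prop
      let φ : Matrix n n ℝ →+ ℝ :=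
        { toFun := fun M => star x ⬝ᵥ (M *ᵥ x)
          map_zero' := by simp
          map_add' := fun M N => by simp [add_mulVec] }
      exact (hf.hasSum.map φ hcont).nonneg fun k => (hfpos k).dotProduct_mulVec_nonneg x
  refine ⟨∑' k, f k, ?_, sub_eq_of_eq_add heq⟩
  rw [heq]
  refine hQ.add_posSemidef ?_
  simpa [conjTranspose_eq_transpose_of_trivial] using hpsd.conjTranspose_mul_mul_same C

/-- The powers of a real matrix whose complex eigenvalues lie in the open unit disk are
norm-summable. -/
theorem summable_norm_pow_of_forall_mem_spectrum {n : Type*} [Fintype n] [DecidableEq n]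
    {C : Matrix n n ℝ} (hC : ∀ μ ∈ spectrum ℂ (C.map Complex.ofReal), ‖μ‖ < 1) :
    Summable fun k : ℕ => ‖C ^ k‖ := by
  cases isEmpty_or_nonempty n
  · simp [Subsingleton.elim _ (0 : Matrix n n ℝ)]
  have : CompleteSpace (Matrix n n ℂ) := FiniteDimensional.complete ℂ _
  refine (summable_norm_pow_of_spectralRadius_lt_one (a := C.map Complex.ofReal) ?_).congr
    fun k => ?_
  · exact_mod_cast spectrum.spectralRadius_lt_of_forall_lt (r := 1) _ fun z hz => hC z hz
  · have : (C ^ k).map Complex.ofReal = C.map Complex.ofReal ^ k :=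
      map_pow Complex.ofRealHom.mapMatrix C k
    rw [← this]
    exact frobenius_norm_map_eq _ _ fun a => Complex.norm_real a

end

open Matrix in
/-- **Lyapunov's theorem for Hurwitz matrices.**
If every eigenvalue of the real matrix `A` (regarded over `ℂ`) has strictly negative
real part, then there is a symmetric positive definite `P` with `Aᵀ P + P A = -I`. -/
theorem lyapunov_equation_of_hurwitz (n : ℕ) (A : Matrix (Fin n) (Fin n) ℝ)
    (hA : ∀ μ ∈ spectrum ℂ (A.map Complex.ofReal), μ.re < 0) :
    ∃ P : Matrix (Fin n) (Fin n) ℝ, P.IsSymm ∧ P.PosDef ∧ Aᵀ * P + P * A = -1 := by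
  let φ : Matrix (Fin n) (Fin n) ℝ →+* Matrix (Fin n) (Fin n) ℂ := Complex.ofRealHom.mapMatrix
  have hM : IsUnit (1 - A).det := by
    have h1 : IsUnit (φ (1 - A)) := by
      rw [map_sub, map_one]
      by_contra hn
      have := hA 1 (by rwa [spectrum.mem_iff, map_one])
      norm_num at this
    rw [isUnit_iff_isUnit_det, ← RingHom.map_det, isUnit_iff_ne_zero] at h1
    exact isUnit_iff_ne_zero.mpr fun h => h1 (by rw [h, map_zero])
  let C := (1 + A) * (1 - A)⁻¹
  have hCM : C * (1 - A) = 1 + A := nonsing_inv_mul_cancel_right _ _ hM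
  have hsum := summable_norm_pow_of_forall_mem_spectrum (C := C) fun μ hμ =>
    norm_lt_one_of_mem_spectrum_cayley hA
      (by simpa using congrArg φ hCM : φ C * (1 - φ A) = 1 + φ A) hμ
  have hQ : ((2 : ℝ) • ((1 - A)⁻¹ᵀ * (1 - A)⁻¹)).PosDef := by
    have hinj : Function.Injective (1 - A)⁻¹.mulVec :=
      mulVec_injective_iff_isUnit.mpr
        (isUnit_nonsing_inv_iff.mpr ((isUnit_iff_isUnit_det _).mpr hM))
    simpa [conjTranspose_eq_transpose_of_trivial] using
      ((PosDef.one (n := Fin n) (R := ℝ)).conjTranspose_mul_mul_same hinj).smul (two_pos (α := ℝ))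
  obtain ⟨P, hP, hPC⟩ := exists_posDef_stein hsum hQ
  refine ⟨P, hP.isHermitian, hP, ?_⟩
  have hinv : (1 - A)⁻¹ * (1 - A) = 1 := nonsing_inv_mul _ hM
  have key : (1 - A)ᵀ * P * (1 - A) - (1 + A)ᵀ * P * (1 + A) = (2 : ℝ) • 1 := by
    calc _ = (1 - A)ᵀ * (P - Cᵀ * P * C) * (1 - A) := by
          rw [← hCM, transpose_mul]
          noncomm_ring
      _ = (2 : ℝ) • (((1 - A)⁻¹ * (1 - A))ᵀ * ((1 - A)⁻¹ * (1 - A))) := by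
          rw [hPC, transpose_mul]
          simp only [Matrix.mul_smul, Matrix.smul_mul, Matrix.mul_assoc]
      _ = (2 : ℝ) • 1 := by rw [hinv, transpose_one, one_mul]
  have hexp : (1 - A)ᵀ * P * (1 - A) - (1 + A)ᵀ * P * (1 + A) = (2 : ℝ) • -(Aᵀ * P + P * A) := by
    rw [transpose_sub, transpose_add, transpose_one, two_smul]
    noncomm_ring
  rw [hexp] at key
  exact neg_eq_iff_eq_neg.mp (smul_right_injective _ (two_ne_zero (α := ℝ)) key)
end

section
/- Let L be a real n×n matrix all of whose eigenvalues, regarded over the complex numbers, have strictly positive real part. Let c : [0,∞) → ℝ be continuous with c(t) ≥ 0 for all t and ∫₀ᵗ c(s) ds → ∞ as t → ∞. If x : [0,∞) → ℝ^n is differentiable and satisfies x′(t) = −c(t)·L·x(t) for all t ≥ 0, then x(t) → 0 as t → ∞. -/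
open Filter Topology Polynomial

/-- A scalar equation `u' = -c (μ u + w)` with `Re μ > 0`, a gain `c ≥ 0` whose primitive `G`
diverges, and a vanishing perturbation `w` has only vanishing solutions. -/
lemma tendsto_zero_of_perturbed_scalar_ode {c G : ℝ → ℝ} {μ : ℂ} (hμ : 0 < μ.re)
    (hG : ∀ t, HasDerivAt G (c t) t) (hc0 : ∀ t, 0 ≤ c t) (hdiv : Tendsto G atTop atTop)
    {u w : ℝ → ℂ} (hw : Tendsto w atTop (𝓝 0))
    (hu : ∀ t, 0 ≤ t → HasDerivWithinAt u (-(c t : ℂ) * (μ * u t + w t)) (Set.Ici 0) t) :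
    Tendsto u atTop (𝓝 0) := by
  rw [Metric.tendsto_atTop]
  intro ε hε
  set a := μ.re with ha
  have hδ : 0 < ε * a / 2 := by positivity
  obtain ⟨T₀, hT₀⟩ := Metric.tendsto_atTop.1 hw _ hδ
  set T := max T₀ 0 with hT
  have hT0 : 0 ≤ T := le_max_right _ _
  set z : ℝ → ℂ := fun t => Complex.exp (μ * G t) * u t with hz
  have hnorm : ∀ t, ‖Complex.exp (μ * G t)‖ = Real.exp (a * G t) := by
    intro t
    simp [Complex.norm_exp, ha]
  have hzd : ∀ t, 0 ≤ t → HasDerivWithinAt z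
      (-(c t : ℂ) * Complex.exp (μ * G t) * w t) (Set.Ici 0) t := by
    intro t ht
    have h1 : HasDerivAt (fun t => Complex.exp (μ * G t))
        (Complex.exp (μ * G t) * (μ * (c t : ℂ))) t :=
      ((hG t).ofReal_comp.const_mul μ).cexp
    refine (h1.hasDerivWithinAt.mul (hu t ht)).congr_deriv ?_
    ring
  have hBd : ∀ t, HasDerivAt
      (fun t => ‖z T‖ + ε / 2 * (Real.exp (a * G t) - Real.exp (a * G T)))
      (ε / 2 * (Real.exp (a * G t) * (a * c t))) t := by
    intro t
    exact ((((hG t).const_mul a).exp.sub_const _).const_mul _).const_add _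
  have hbound : ∀ t, T ≤ t →
      ‖z t‖ ≤ ‖z T‖ + ε / 2 * (Real.exp (a * G t) - Real.exp (a * G T)) := by
    intro t ht
    refine image_norm_le_of_norm_deriv_right_le_deriv_boundary (a := T) (b := t)
      (f' := fun t => -(c t : ℂ) * Complex.exp (μ * G t) * w t) ?_ ?_ ?_ hBd ?_ ⟨ht, le_rfl⟩
    · intro s hs
      exact ((hzd s (hT0.trans hs.1)).mono fun r hr => hT0.trans hr.1).continuousWithinAt
    · intro s hs
      exact (hzd s (hT0.trans hs.1)).mono (Set.Ici_subset_Ici.2 (hT0.trans hs.1))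
    · simp
    · intro s hs
      have h2 : ‖w s‖ ≤ ε * a / 2 := by
        simpa using (hT₀ s ((le_max_left _ _).trans hs.1)).le
      have h3 : 0 ≤ c s * Real.exp (a * G s) := mul_nonneg (hc0 s) (Real.exp_pos _).le
      rw [norm_mul, norm_mul, norm_neg, Complex.norm_real, Real.norm_of_nonneg (hc0 s), hnorm]
      calc _ ≤ c s * Real.exp (a * G s) * (ε * a / 2) := mul_le_mul_of_nonneg_left h2 h3
        _ = _ := by ring
  have hdecay : Tendsto (fun t => ‖z T‖ * Real.exp (-(a * G t))) atTop (𝓝 0) := by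
    have := (Real.tendsto_exp_neg_atTop_nhds_zero.comp (hdiv.const_mul_atTop hμ)).const_mul ‖z T‖
    simpa using this
  obtain ⟨T₁, hT₁⟩ := Metric.tendsto_atTop.1 hdecay _ (half_pos hε)
  refine ⟨max T T₁, fun t ht => ?_⟩
  have h1 := hbound t ((le_max_left _ _).trans ht)
  have h2 := (le_abs_self _).trans_lt
    (by simpa only [Real.dist_eq, sub_zero] using hT₁ t ((le_max_right _ _).trans ht))
  simp only [hz, norm_mul, hnorm] at h1
  rw [Real.exp_neg, ← div_eq_mul_inv, div_lt_iff₀ (Real.exp_pos _)] at h2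
  simp only [hz, norm_mul, hnorm] at h2
  rw [dist_zero_right]
  have h3 := Real.exp_pos (a * G t)
  have h4 := mul_pos hε (Real.exp_pos (a * G T))
  refine lt_of_mul_lt_mul_left (a := Real.exp (a * G t)) ?_ h3.le
  linarith

/-- A solution `y` of `y' = -c M y` vanishes at infinity as soon as `p(M) y` does, for some product
`p` of linear factors whose roots have positive real part. -/
lemma tendsto_zero_of_tendsto_aeval_mulVec {n : ℕ} {c G : ℝ → ℝ}
    (hG : ∀ t, HasDerivAt G (c t) t) (hc0 : ∀ t, 0 ≤ c t) (hdiv : Tendsto G atTop atTop)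
    (M : Matrix (Fin n) (Fin n) ℂ) (s : Multiset ℂ) (hs : ∀ μ ∈ s, 0 < μ.re)
    (y : ℝ → Fin n → ℂ)
    (hy : ∀ t, 0 ≤ t → HasDerivWithinAt y (-(c t : ℂ) • M.mulVec (y t)) (Set.Ici 0) t)
    (hlim : Tendsto (fun t => (aeval M (s.map fun μ => X - C μ).prod).mulVec (y t))
      atTop (𝓝 0)) :
    Tendsto y atTop (𝓝 0) := by
  induction s using Multiset.induction_on generalizing y with
  | empty => simpa using hlim
  | cons μ s ih =>
    set N : Matrix (Fin n) (Fin n) ℂ := M - algebraMap ℂ _ μ with hN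
    have hcomm : N * M = M * N := by
      rw [hN, sub_mul, mul_sub, Algebra.commutes]
    have hNy : Tendsto (fun t => N.mulVec (y t)) atTop (𝓝 0) := by
      refine ih (fun ν hν => hs ν (Multiset.mem_cons_of_mem hν)) _ (fun t ht => ?_) ?_
      · have h := (N.mulVecLin.restrictScalars ℝ).toContinuousLinearMap.hasFDerivAt
          |>.comp_hasDerivWithinAt t (hy t ht)
        refine h.congr_deriv ?_
        change N.mulVec (-(c t : ℂ) • M.mulVec (y t)) = _
        rw [Matrix.mulVec_smul, Matrix.mulVec_mulVec, Matrix.mulVec_mulVec, hcomm]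
      · refine hlim.congr fun t => ?_
        rw [Multiset.map_cons, Multiset.prod_cons, mul_comm, map_mul, Matrix.mulVec_mulVec]
        simp [hN]
    rw [tendsto_pi_nhds] at hNy ⊢
    intro i
    refine tendsto_zero_of_perturbed_scalar_ode (hs μ (Multiset.mem_cons_self _ _)) hG hc0 hdiv
      (hNy i) fun t ht => ?_
    refine (hasDerivWithinAt_pi.1 (hy t ht) i).congr_deriv ?_
    simp [hN, Matrix.sub_mulVec, Matrix.algebraMap_eq_diagonal, Matrix.mulVec_diagonal]

/-- **Noise-free core of Theorem 1 (fixed topology).**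
If every eigenvalue of `L` (over `ℂ`) has strictly positive real part, `c` is a continuous
nonnegative gain on `[0,∞)` whose integral diverges, and `x` solves `x' = -c(t) L x`
on `[0,∞)`, then `x(t) → 0` as `t → ∞`. -/
theorem ode_convergence_of_positive_spectrum (n : ℕ) (L : Matrix (Fin n) (Fin n) ℝ)
    (hL : ∀ μ ∈ spectrum ℂ (L.map Complex.ofReal), 0 < μ.re)
    (c : ℝ → ℝ) (hc : ContinuousOn c (Set.Ici 0))
    (hc0 : ∀ t : ℝ, 0 ≤ t → 0 ≤ c t)
    (hcdiv : Filter.Tendsto (fun t : ℝ => ∫ s in (0:ℝ)..t, c s) Filter.atTop Filter.atTop)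
    (x : ℝ → Fin n → ℝ)
    (hx : ∀ t : ℝ, 0 ≤ t →
      HasDerivWithinAt x (-(c t) • L.mulVec (x t)) (Set.Ici 0) t) :
    Filter.Tendsto x Filter.atTop (nhds 0) := by
  set d : ℝ → ℝ := fun t => c (max t 0) with hd
  have hdc : Continuous d :=
    hc.comp_continuous (continuous_id.max continuous_const) fun t =>
      Set.mem_Ici.2 (le_max_right _ _)
  have hdt : ∀ t, 0 ≤ t → d t = c t := fun t ht => by simp [hd, ht]
  have hD : ∀ t, HasDerivAt (fun t => ∫ s in (0:ℝ)..t, d s) (d t) t := fun t =>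
    hdc.integral_hasStrictDerivAt 0 t |>.hasDerivAt
  have hDdiv : Filter.Tendsto (fun t => ∫ s in (0:ℝ)..t, d s) Filter.atTop Filter.atTop := by
    refine hcdiv.congr' ?_
    filter_upwards [Filter.eventually_ge_atTop 0] with t ht
    refine intervalIntegral.integral_congr fun s hs => ?_
    rw [Set.uIcc_of_le ht] at hs
    exact (hdt s hs.1).symm
  set M : Matrix (Fin n) (Fin n) ℂ := L.map Complex.ofReal with hM
  have hroots : ∀ μ ∈ M.charpoly.roots, 0 < μ.re := fun μ hμ =>
    hL μ (Matrix.mem_spectrum_iff_isRoot_charpoly.2 (isRoot_of_mem_roots hμ))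
  have hprod : (M.charpoly.roots.map fun μ => X - C μ).prod = M.charpoly :=
    ((IsAlgClosed.splits M.charpoly).eq_prod_roots_of_monic M.charpoly_monic).symm
  have hy := tendsto_zero_of_tendsto_aeval_mulVec hD (fun t => hc0 _ (le_max_right _ _)) hDdiv M
    M.charpoly.roots hroots (fun t i => (x t i : ℂ)) (fun t ht => ?_) ?_
  · rw [tendsto_pi_nhds] at hy ⊢
    intro i
    simpa [Function.comp_def] using (Complex.continuous_re.tendsto 0).comp (hy i)
  · rw [hasDerivWithinAt_pi]
    intro i
    refine (hasDerivWithinAt_pi.1 (hx t ht) i).ofReal_comp.congr_deriv ?_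
    simp [hdt t ht, hM, Matrix.mulVec, dotProduct]
  · rw [hprod, Matrix.aeval_self_charpoly]
    simp
end

section
/- Let L : [0,∞) → ℝ^{n×n} be a family of real matrices and Λ > 0 a constant such that xᵀ(L(t) + L(t)ᵀ)x ≥ Λ·‖x‖² for all t ≥ 0 and all x ∈ ℝ^n. Let c : [0,∞) → ℝ be continuous with c(t) ≥ 0 for all t and ∫₀ᵗ c(s) ds → ∞ as t → ∞. If x : [0,∞) → ℝ^n is differentiable and satisfies x′(t) = −c(t)·L(t)·x(t) for all t ≥ 0, then ‖x(t)‖² ≤ exp(−Λ·∫₀ᵗ c(s) ds)·‖x(0)‖² for all t ≥ 0, and consequently x(t) → 0 as t → ∞. -/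
open scoped Matrix in
/-- The quadratic form of `A + Aᵀ` is twice that of `A`. -/
theorem sum_mul_add_transpose_mulVec {ι : Type*} [Fintype ι] (A : Matrix ι ι ℝ) (v : ι → ℝ) :
    ∑ i, v i * ((A + A.transpose).mulVec v) i = 2 * ∑ i, v i * (A.mulVec v) i := by
  change v ⬝ᵥ (A + A.transpose).mulVec v = 2 * (v ⬝ᵥ A.mulVec v)
  rw [Matrix.add_mulVec, dotProduct_add, Matrix.mulVec_transpose, dotProduct_comm v (v ᵥ* A),
    ← Matrix.dotProduct_mulVec, two_mul]

/-- Grönwall's inequality on `[0,∞)` with a time-varying decay rate `k`. -/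
theorem le_exp_neg_integral_mul_of_hasDerivWithinAt {V V' k : ℝ → ℝ}
    (hk : ContinuousOn k (Set.Ici 0))
    (hV : ∀ t, 0 ≤ t → HasDerivWithinAt V (V' t) (Set.Ici 0) t)
    (hle : ∀ t, 0 ≤ t → V' t ≤ -(k t * V t)) {t : ℝ} (ht : 0 ≤ t) :
    V t ≤ Real.exp (-∫ s in (0 : ℝ)..t, k s) * V 0 := by
  have hcont : Continuous fun s => k (max 0 s) :=
    hk.comp_continuous (continuous_const.max continuous_id) fun s => le_max_left 0 s
  set K : ℝ → ℝ := fun u => ∫ s in (0 : ℝ)..u, k (max 0 s) with hK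
  have hKt : ∫ s in (0 : ℝ)..t, k s = K t := by
    refine intervalIntegral.integral_congr fun s hs => ?_
    rw [Set.uIcc_of_le ht] at hs
    simp only [max_eq_right hs.1]
  have hderiv : ∀ u, 0 ≤ u → HasDerivWithinAt (fun u => Real.exp (K u) * V u)
      (Real.exp (K u) * k u * V u + Real.exp (K u) * V' u) (Set.Ici 0) u := by
    intro u hu
    have h : HasDerivAt K (k u) u := by
      simpa only [max_eq_right hu] using (hcont.integral_hasStrictDerivAt 0 u).hasDerivAt
    exact h.exp.hasDerivWithinAt.mul (hV u hu)
  have hanti : AntitoneOn (fun u => Real.exp (K u) * V u) (Set.Ici 0) := by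
    refine antitoneOn_of_hasDerivWithinAt_nonpos (convex_Ici 0)
      (fun u hu => (hderiv u hu).continuousWithinAt)
      (fun u hu => (hderiv u (interior_subset hu)).mono interior_subset) fun u hu => ?_
    have h := mul_le_mul_of_nonneg_left (hle u (interior_subset hu)) (Real.exp_pos (K u)).le
    linarith
  have h := hanti Set.self_mem_Ici ht ht
  simp only [hK, intervalIntegral.integral_same, Real.exp_zero, one_mul] at h
  rw [hKt, Real.exp_neg, ← div_eq_inv_mul, le_div_iff₀ (Real.exp_pos _), mul_comm]
  exact h


open Matrix in
/-- **Noise-free core of Theorem 3 (time-varying topology).**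
If `L(t) + L(t)ᵀ ⪰ Λ·I` uniformly in `t ≥ 0` (as a quadratic form, with respect to the
Euclidean norm), `c` is a continuous nonnegative gain whose integral diverges, and `x`
solves `x' = -c(t) L(t) x` on `[0,∞)`, then
`‖x(t)‖² ≤ exp(-Λ ∫₀ᵗ c) ‖x(0)‖²` and `x(t) → 0`. -/
theorem ode_convergence_time_varying (n : ℕ) (L : ℝ → Matrix (Fin n) (Fin n) ℝ)
    (Λ : ℝ) (hΛ : 0 < Λ)
    (hL : ∀ t : ℝ, 0 ≤ t → ∀ v : Fin n → ℝ,
      Λ * ∑ i, (v i) ^ 2 ≤ ∑ i, v i * ((L t + (L t)ᵀ).mulVec v) i)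
    (c : ℝ → ℝ) (hc : ContinuousOn c (Set.Ici 0))
    (hc0 : ∀ t : ℝ, 0 ≤ t → 0 ≤ c t)
    (hcdiv : Filter.Tendsto (fun t : ℝ => ∫ s in (0:ℝ)..t, c s) Filter.atTop Filter.atTop)
    (x : ℝ → Fin n → ℝ)
    (hx : ∀ t : ℝ, 0 ≤ t →
      HasDerivWithinAt x (-(c t) • (L t).mulVec (x t)) (Set.Ici 0) t) :
    (∀ t : ℝ, 0 ≤ t →
      ∑ i, (x t i) ^ 2 ≤ Real.exp (-(Λ * ∫ s in (0:ℝ)..t, c s)) * ∑ i, (x 0 i) ^ 2) ∧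
    Filter.Tendsto x Filter.atTop (nhds 0) := by
  have hbound : ∀ t : ℝ, 0 ≤ t →
      ∑ i, (x t i) ^ 2 ≤ Real.exp (-(Λ * ∫ s in (0:ℝ)..t, c s)) * ∑ i, (x 0 i) ^ 2 := by
    intro t ht
    rw [← intervalIntegral.integral_const_mul]
    refine le_exp_neg_integral_mul_of_hasDerivWithinAt (V := fun t => ∑ i, (x t i) ^ 2)
      (V' := fun t => ∑ i, 2 * x t i * (-(c t) • (L t).mulVec (x t)) i)
      (hc.const_mul Λ) (fun u hu => ?_) (fun u hu => ?_) ht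
    · refine HasDerivWithinAt.fun_sum fun i _ => ?_
      simpa using (hasDerivWithinAt_pi.1 (hx u hu) i).fun_pow 2
    · have h := mul_le_mul_of_nonneg_left (hL u hu (x u)) (hc0 u hu)
      rw [sum_mul_add_transpose_mulVec] at h
      have hsum : ∑ i, 2 * x u i * (-(c u) • (L u).mulVec (x u)) i =
          -(c u * (2 * ∑ i, x u i * ((L u).mulVec (x u)) i)) := by
        simp only [Pi.smul_apply, smul_eq_mul, Finset.mul_sum, ← Finset.sum_neg_distrib]
        exact Finset.sum_congr rfl fun i _ => by ring
      simp only [hsum]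
      linarith
  refine ⟨hbound, tendsto_pi_nhds.2 fun i => ?_⟩
  have hexp : Filter.Tendsto
      (fun t => Real.exp (-(Λ * ∫ s in (0:ℝ)..t, c s)) * ∑ i, (x 0 i) ^ 2)
      Filter.atTop (nhds 0) := by
    simpa using (Real.tendsto_exp_neg_atTop_nhds_zero.comp
      (hcdiv.const_mul_atTop hΛ)).mul_const (∑ i, (x 0 i) ^ 2)
  have hsq : Filter.Tendsto (fun t => (x t i) ^ 2) Filter.atTop (nhds 0) := by
    refine squeeze_zero' (Filter.Eventually.of_forall fun t => sq_nonneg _) ?_ hexp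
    filter_upwards [Filter.eventually_ge_atTop 0] with t ht
    exact (Finset.single_le_sum (f := fun j => (x t j) ^ 2) (fun j _ => sq_nonneg _)
      (Finset.mem_univ i)).trans (hbound t ht)
  rw [Pi.zero_apply, tendsto_zero_iff_abs_tendsto_zero]
  simpa [Function.comp_def, Real.sqrt_sq_eq_abs] using hsq.sqrt
end

section
/- Let t₀ ≥ 0, let μ : [t₀,∞) → ℝ be continuous with μ(t) ≥ 0 for all t and ∫_{t₀}ᵗ μ(u) du → ∞ as t → ∞, and let c : [t₀,∞) → ℝ be continuous such that for every ε > 0 there exists T ≥ t₀ with c(t)² ≤ ε·μ(t) for all t ≥ T. Then ∫_{t₀}ᵗ exp(−∫_sᵗ μ(u) du)·c(s)² ds → 0 as t → ∞. -/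
open Filter Set MeasureTheory intervalIntegral

theorem ContinuousOn.intervalIntegrable_of_Ici {a : ℝ} {f : ℝ → ℝ} (hf : ContinuousOn f (Ici a))
    {x y : ℝ} (hx : a ≤ x) (hy : a ≤ y) : IntervalIntegrable f volume x y :=
  (hf.mono fun _ hz => (le_min hx hy).trans hz.1).intervalIntegrable

theorem ContinuousOn.hasDerivAt_integral_of_Ici {a : ℝ} {f : ℝ → ℝ} (hf : ContinuousOn f (Ici a))
    {x : ℝ} (hx : a < x) : HasDerivAt (fun t => ∫ u in a..t, f u) (f x) x :=
  integral_hasDerivAt_right (hf.intervalIntegrable_of_Ici le_rfl hx.le)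
    ((hf.mono Ioi_subset_Ici_self).stronglyMeasurableAtFilter isOpen_Ioi x hx)
    (hf.continuousAt (Ici_mem_nhds hx))

theorem ContinuousOn.continuousOn_integral_of_Ici {a : ℝ} {f : ℝ → ℝ}
    (hf : ContinuousOn f (Ici a)) : ContinuousOn (fun t => ∫ u in a..t, f u) (Ici a) := by
  intro x hx
  have hax : a ≤ x + 1 := by linarith [mem_Ici.1 hx]
  have hint : IntegrableOn f (uIcc a (x + 1)) volume := by
    rw [uIcc_of_le hax]
    exact (hf.mono Icc_subset_Ici_self).integrableOn_Icc
  have h := continuousOn_primitive_interval hint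
  rw [uIcc_of_le hax] at h
  refine (h x ⟨hx, by linarith⟩).mono_of_mem_nhdsWithin ?_
  filter_upwards [self_mem_nhdsWithin, mem_nhdsWithin_of_mem_nhds (Iic_mem_nhds (lt_add_one x))]
    with y hy hy' using ⟨hy, hy'⟩

/-- The integral of `exp (∫ f) * f` is the increment of `exp (∫ f)`. -/
theorem ContinuousOn.integral_exp_integral_mul {a : ℝ} {f : ℝ → ℝ} (hf : ContinuousOn f (Ici a))
    {x y : ℝ} (hx : a ≤ x) (hxy : x ≤ y) :
    ∫ s in x..y, Real.exp (∫ u in a..s, f u) * f s =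
      Real.exp (∫ u in a..y, f u) - Real.exp (∫ u in a..x, f u) := by
  have hexp : ContinuousOn (fun s => Real.exp (∫ u in a..s, f u)) (Ici a) :=
    hf.continuousOn_integral_of_Ici.rexp
  exact integral_eq_sub_of_hasDerivAt_of_le hxy (hexp.mono fun _ hz => hx.trans hz.1)
    (fun s hs => (hf.hasDerivAt_integral_of_Ici (hx.trans_lt hs.1)).exp)
    ((hexp.mul hf).intervalIntegrable_of_Ici hx (hx.trans hxy))

/-- **The key L'Hôpital-type limit in the proof of Theorem 1.**
If `μ ≥ 0` is continuous with divergent integral and `c` is continuous with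
`c² = o(μ)` (in the sense that for every `ε > 0` eventually `c(t)² ≤ ε·μ(t)`), then
`∫_{t₀}^t e^{-∫_s^t μ} c(s)² ds → 0` as `t → ∞`. -/
theorem convolution_limit_zero (t₀ : ℝ) (ht₀ : 0 ≤ t₀) (μ c : ℝ → ℝ)
    (hμcont : ContinuousOn μ (Set.Ici t₀))
    (hμ0 : ∀ t : ℝ, t₀ ≤ t → 0 ≤ μ t)
    (hμdiv : Filter.Tendsto (fun t : ℝ => ∫ u in t₀..t, μ u) Filter.atTop Filter.atTop)
    (hccont : ContinuousOn c (Set.Ici t₀))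
    (hdom : ∀ ε : ℝ, 0 < ε → ∃ T : ℝ, t₀ ≤ T ∧ ∀ t : ℝ, T ≤ t → (c t) ^ 2 ≤ ε * μ t) :
    Filter.Tendsto
      (fun t : ℝ => ∫ s in t₀..t, Real.exp (-(∫ u in s..t, μ u)) * (c s) ^ 2)
      Filter.atTop (nhds 0) := by
  set M : ℝ → ℝ := fun t => ∫ u in t₀..t, μ u with hM
  have hg : ContinuousOn (fun s => Real.exp (M s) * c s ^ 2) (Ici t₀) :=
    hμcont.continuousOn_integral_of_Ici.rexp.mul (hccont.pow 2)
  have hfactor : ∀ t, t₀ ≤ t →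
      ∫ s in t₀..t, Real.exp (-(∫ u in s..t, μ u)) * c s ^ 2 =
        Real.exp (-M t) * ∫ s in t₀..t, Real.exp (M s) * c s ^ 2 := by
    intro t ht
    rw [← intervalIntegral.integral_const_mul]
    refine integral_congr fun s hs => ?_
    rw [uIcc_of_le ht] at hs
    have hsub : ∫ u in s..t, μ u = M t - M s :=
      (integral_interval_sub_left (hμcont.intervalIntegrable_of_Ici le_rfl ht)
        (hμcont.intervalIntegrable_of_Ici le_rfl hs.1)).symm
    simp only [hsub]
    rw [← mul_assoc, ← Real.exp_add]
    ring_nf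
  have hdecay : Tendsto (fun t => Real.exp (-M t)) atTop (nhds 0) :=
    Real.tendsto_exp_neg_atTop_nhds_zero.comp hμdiv
  rw [Metric.tendsto_nhds]
  intro ε hε
  obtain ⟨T, hT, hcT⟩ := hdom (ε / 2) (half_pos hε)
  have hhead := hdecay.mul_const (∫ s in t₀..T, Real.exp (M s) * c s ^ 2)
  rw [zero_mul] at hhead
  filter_upwards [hhead.eventually (gt_mem_nhds (half_pos hε)), eventually_ge_atTop T]
    with t hsmall hTt
  have ht := hT.trans hTt
  have hnonneg : 0 ≤ ∫ s in t₀..t, Real.exp (M s) * c s ^ 2 :=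
    integral_nonneg ht fun s _ => by positivity
  rw [hfactor t ht, Real.dist_eq, sub_zero, abs_of_nonneg (by positivity),
    ← integral_add_adjacent_intervals (hg.intervalIntegrable_of_Ici le_rfl hT)
      (hg.intervalIntegrable_of_Ici hT ht), mul_add]
  have htail : ∫ s in T..t, Real.exp (M s) * c s ^ 2 ≤ ε / 2 * Real.exp (M t) := by
    calc ∫ s in T..t, Real.exp (M s) * c s ^ 2
        ≤ ∫ s in T..t, ε / 2 * (Real.exp (M s) * μ s) := by
          refine integral_mono_on hTt (hg.intervalIntegrable_of_Ici hT ht)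
            (((hμcont.continuousOn_integral_of_Ici.rexp.mul
              hμcont).intervalIntegrable_of_Ici hT ht).const_mul _) fun s hs => ?_
          rw [mul_left_comm]
          exact mul_le_mul_of_nonneg_left (hcT s hs.1) (Real.exp_pos _).le
      _ = ε / 2 * (Real.exp (M t) - Real.exp (M T)) := by
          rw [intervalIntegral.integral_const_mul, hμcont.integral_exp_integral_mul hT hTt]
      _ ≤ ε / 2 * Real.exp (M t) := by
          gcongr
          linarith [Real.exp_pos (M T)]
  have hscaled : Real.exp (-M t) * ∫ s in T..t, Real.exp (M s) * c s ^ 2 ≤ ε / 2 := by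
    refine (mul_le_mul_of_nonneg_left htail (Real.exp_pos _).le).trans_eq ?_
    rw [mul_left_comm, ← Real.exp_add, neg_add_cancel, Real.exp_zero, mul_one]
  linarith
end

section
/- Let t₀ ≥ 0, let μ : [t₀,∞) → ℝ be continuous with μ(t) ≥ 0 for all t and ∫_{t₀}ᵗ μ(u) du → ∞ as t → ∞, let c : [t₀,∞) → ℝ be continuous such that for every ε > 0 there exists T ≥ t₀ with c(t)² ≤ ε·μ(t) for all t ≥ T, and let K ≥ 0. If g : [t₀,∞) → ℝ is differentiable, g(t) ≥ 0 for all t, and g′(t) ≤ −μ(t)·g(t) + K·c(t)² for all t ≥ t₀, then g(t) → 0 as t → ∞. -/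
open Filter Set Topology

/-- The primitive of a function continuous on `[t₀, ∞)` is differentiable on `(t₀, ∞)`. -/
theorem hasDerivAt_primitive_of_continuousOn_Ici {t₀ t : ℝ} {f : ℝ → ℝ}
    (hf : ContinuousOn f (Ici t₀)) (ht : t₀ < t) :
    HasDerivAt (fun s => ∫ u in t₀..s, f u) (f t) t := by
  refine intervalIntegral.integral_hasDerivAt_right ?_ ?_ (hf.continuousAt (Ici_mem_nhds ht))
  · exact (hf.mono (by rw [uIcc_of_le ht.le]; exact Icc_subset_Ici_self)).intervalIntegrable
  · exact (hf.mono Ioi_subset_Ici_self).stronglyMeasurableAtFilter isOpen_Ioi t ht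

/-- If `g' ≤ -M' (g - η)` on `[a, ∞)`, then `(g - η) exp M` is antitone there. -/
theorem antitoneOn_sub_mul_exp {a η : ℝ} {M m g g' : ℝ → ℝ}
    (hM : ∀ t, a ≤ t → HasDerivAt M (m t) t) (hg : ∀ t, a ≤ t → HasDerivAt g (g' t) t)
    (h : ∀ t, a ≤ t → g' t ≤ -(m t) * (g t - η)) :
    AntitoneOn (fun t => (g t - η) * Real.exp (M t)) (Ici a) := by
  have hd : ∀ t, a ≤ t → HasDerivAt (fun t => (g t - η) * Real.exp (M t))
      (g' t * Real.exp (M t) + (g t - η) * (Real.exp (M t) * m t)) t :=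
    fun t ht => ((hg t ht).sub_const η).mul (hM t ht).exp
  refine antitoneOn_of_hasDerivWithinAt_nonpos (convex_Ici a)
    (fun t ht => (hd t ht).continuousAt.continuousWithinAt)
    (fun t ht => (hd t (interior_subset ht)).hasDerivWithinAt) fun t ht => ?_
  have := mul_le_mul_of_nonneg_right (h t (interior_subset ht)) (Real.exp_pos (M t)).le
  linarith

/-- **Scalar convergence lemma yielding `E(V(t)) → 0` in Theorem 1.**
If `μ ≥ 0` is continuous with divergent integral, `c` is continuous with `c² = o(μ)`,
`K ≥ 0`, and the nonnegative differentiable function `g` satisfies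
`g' ≤ -μ g + K c²` on `[t₀,∞)`, then `g(t) → 0` as `t → ∞`. -/
theorem scalar_convergence_lemma (t₀ : ℝ) (ht₀ : 0 ≤ t₀) (μ c : ℝ → ℝ)
    (hμcont : ContinuousOn μ (Set.Ici t₀))
    (hμ0 : ∀ t : ℝ, t₀ ≤ t → 0 ≤ μ t)
    (hμdiv : Filter.Tendsto (fun t : ℝ => ∫ u in t₀..t, μ u) Filter.atTop Filter.atTop)
    (hccont : ContinuousOn c (Set.Ici t₀))
    (hdom : ∀ ε : ℝ, 0 < ε → ∃ T : ℝ, t₀ ≤ T ∧ ∀ t : ℝ, T ≤ t → (c t) ^ 2 ≤ ε * μ t)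
    (K : ℝ) (hK : 0 ≤ K) (g g' : ℝ → ℝ)
    (hg : ∀ t : ℝ, t₀ ≤ t → HasDerivWithinAt g (g' t) (Set.Ici t₀) t)
    (hg0 : ∀ t : ℝ, t₀ ≤ t → 0 ≤ g t)
    (hineq : ∀ t : ℝ, t₀ ≤ t → g' t ≤ -(μ t) * g t + K * (c t) ^ 2) :
    Filter.Tendsto g Filter.atTop (nhds 0) := by
  refine tendsto_order.2 ⟨fun a ha => ?_, fun ε hε => ?_⟩
  · filter_upwards [eventually_ge_atTop t₀] with t ht using ha.trans_le (hg0 t ht)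
  obtain ⟨T, hT, hc⟩ := hdom (ε / 2 / (K + 1)) (by positivity)
  have hlt : ∀ t, T + 1 ≤ t → t₀ < t := fun t ht => by linarith
  have hanti := antitoneOn_sub_mul_exp (a := T + 1) (η := ε / 2)
    (fun t ht => hasDerivAt_primitive_of_continuousOn_Ici hμcont (hlt t ht))
    (fun t ht => (hg t (hlt t ht).le).hasDerivAt (Ici_mem_nhds (hlt t ht))) fun t ht => by
      have hKc : K * c t ^ 2 ≤ ε / 2 * μ t := calc
        K * c t ^ 2 ≤ (K + 1) * c t ^ 2 := by gcongr; linarith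
        _ ≤ (K + 1) * (ε / 2 / (K + 1) * μ t) := by
          gcongr
          exact hc t (by linarith)
        _ = ε / 2 * μ t := by field_simp
      linarith [hineq t (hlt t ht).le]
  set M : ℝ → ℝ := fun t => ∫ u in t₀..t, μ u
  set C := (g (T + 1) - ε / 2) * Real.exp (M (T + 1))
  have hlim : Tendsto (fun t => C * Real.exp (-M t)) atTop (𝓝 0) := by
    simpa using (Real.tendsto_exp_neg_atTop_nhds_zero.comp hμdiv).const_mul C
  filter_upwards [hlim.eventually_lt_const (half_pos hε), eventually_ge_atTop (T + 1)]
    with t hsmall ht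
  have hle : (g t - ε / 2) * Real.exp (M t) ≤ C := hanti self_mem_Ici ht ht
  have := mul_le_mul_of_nonneg_right hle (Real.exp_pos (-M t)).le
  rw [mul_assoc, ← Real.exp_add, add_neg_cancel, Real.exp_zero, mul_one] at this
  linarith
end
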